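/- Let G be the group with generators e_0, e_1, e_2, e_3, generators y_{i,1}, y_{i,2} for i ∈ {0,1,2,3}, and generators y_{ij,1}, y_{ij,2}, y_{ij,3} for (i,j) ∈ {(0,1), (0,2), (1,3), (2,3)}; write y_i := [y_{i,1}, y_{i,2}] and y_{ij} := [[y_{ij,1}, y_{ij,2}], y_{ij,3}]; the relations are e_i^{3^{2i}} = y_i for i ∈ {0,1,2,3} and e_j^{3^{12−i}}·e_i^{3^{12−j}} = y_{ij}^{3^{12−2i−2j}} for (i,j) ∈ {(0,1), (0,2), (1,3), (2,3)} (i.e. G is the quotient of the free group on all listed generators by the normal closure of the corresponding relators). Then the element ω := [[e_2, e_1], e_0]^{3⁹} belongs to the dimension subgroup δ_7(G). -/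

import Mathlib

open scoped commutatorElement

/-- The augmentation ideal of the integral group ring `ℤG`. -/
noncomputable def augIdeal (G : Type*) [Group G] : Submodule ℤ (MonoidAlgebra ℤ G) :=
  Submodule.restrictScalars ℤ
    (RingHom.ker ((MonoidAlgebra.lift ℤ ℤ G) 1).toRingHom)

/-- The `n`-th dimension subgroup `δ_n(G) = {g ∈ G : g - 1 ∈ ϖ^n}`. -/
noncomputable def dimensionSubgroup (G : Type*) [Group G] (n : ℕ) : Set G :=
  {g : G | (MonoidAlgebra.of ℤ G g : MonoidAlgebra ℤ G) - 1 ∈ (augIdeal G) ^ n}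

/-- The four index pairs `(0,1), (0,2), (1,3), (2,3)`. -/
def pairIdx : Fin 4 → Fin 4 × Fin 4 := ![(0, 1), (0, 2), (1, 3), (2, 3)]

/-- The generating set: `e_0, …, e_3`; `y_{i,1}, y_{i,2}` for `i ∈ Fin 4`; and
`y_{ij,1}, y_{ij,2}, y_{ij,3}` for the four pairs `(i,j)`. -/
abbrev TGen : Type := Fin 4 ⊕ (Fin 4 × Fin 2) ⊕ (Fin 4 × Fin 3)

/-- The free generators `e_i`. -/
def eF (i : Fin 4) : FreeGroup TGen := FreeGroup.of (Sum.inl i)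

/-- `y_i := [y_{i,1}, y_{i,2}]`. -/
def yF (i : Fin 4) : FreeGroup TGen :=
  ⁅FreeGroup.of ((Sum.inr (Sum.inl (i, 0)) : TGen)),
   FreeGroup.of ((Sum.inr (Sum.inl (i, 1)) : TGen))⁆

/-- `y_{ij} := [[y_{ij,1}, y_{ij,2}], y_{ij,3}]` for the `k`-th pair `(i,j)`. -/
def yyF (k : Fin 4) : FreeGroup TGen :=
  ⁅⁅FreeGroup.of ((Sum.inr (Sum.inr (k, 0)) : TGen)),
    FreeGroup.of ((Sum.inr (Sum.inr (k, 1)) : TGen))⁆,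
   FreeGroup.of ((Sum.inr (Sum.inr (k, 2)) : TGen))⁆

/-- The relators `e_i^{3^{2i}}·y_i⁻¹` and
`e_j^{3^{12-i}}·e_i^{3^{12-j}}·(y_{ij}^{3^{12-2i-2j}})⁻¹`. -/
def tRels : Set (FreeGroup TGen) :=
  {w | ∃ i : Fin 4, w = eF i ^ (3 ^ (2 * (i : ℕ))) * (yF i)⁻¹} ∪
  {w | ∃ k : Fin 4, w =
    eF (pairIdx k).2 ^ (3 ^ (12 - ((pairIdx k).1 : ℕ)))
      * eF (pairIdx k).1 ^ (3 ^ (12 - ((pairIdx k).2 : ℕ)))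
      * (yyF k ^ (3 ^ (12 - 2 * ((pairIdx k).1 : ℕ) - 2 * ((pairIdx k).2 : ℕ))))⁻¹}

/-- The group `G` presented by the above generators and relators. -/
def TGrp : Type := PresentedGroup tRels

instance : Group TGrp := inferInstanceAs (Group (PresentedGroup tRels))

/-- The images `e_i` of the generators in `G`. -/
def eT (i : Fin 4) : TGrp := PresentedGroup.of (Sum.inl i)

section ring
variable {R : Type*} [Ring R]

/-- `3^k z` lies in `I^d`. -/
def PP (I : Submodule ℤ R) (k d : ℕ) (z : R) : Prop := ((3 : ℤ) ^ k) • z ∈ I ^ d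

/-- contexts -/
def CC (I : Submodule ℤ R) (k d : ℕ) (u v : R) : Prop :=
  ∀ k' d' z, PP I k' d' z → PP I (k + k') (d + d') (u * z * v)

/-- two-sided ideal -/
def TS (I : Submodule ℤ R) : Prop := ∀ a ∈ I, ∀ r : R, a * r ∈ I ∧ r * a ∈ I

theorem pow_anti {I : Submodule ℤ R} (hI : TS I) (d : ℕ) (hd : 1 ≤ d) (e : ℕ) (h : d ≤ e) :
    I ^ e ≤ I ^ d := by
  have h1 : ∀ d, 1 ≤ d → I ^ (d + 1) ≤ I ^ d := by
    intro d hd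
    obtain ⟨d, rfl⟩ := Nat.exists_eq_add_of_le' hd
    rw [pow_succ I (d + 1), pow_succ I d, mul_assoc]
    refine mul_le_mul' le_rfl ?_
    rw [Submodule.mul_le]
    intro a ha b _
    exact (hI a ha b).1
  induction e, h using Nat.le_induction with
  | base => exact le_rfl
  | succ e he ih => exact (h1 _ (hd.trans he)).trans ih

theorem PP.mono {I : Submodule ℤ R} (hI : TS I) {k d : ℕ} {z : R} (h : PP I k d z)
    (k' d' : ℕ) (hk : k ≤ k') (hd' : 1 ≤ d') (hd : d' ≤ d) : PP I k' d' z := by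
  unfold PP at *
  obtain ⟨j, rfl⟩ := Nat.exists_eq_add_of_le hk
  rw [pow_add, mul_comm, mul_smul]
  exact Submodule.smul_mem _ _ (pow_anti hI d' hd' d hd h)

theorem PP.mul {I : Submodule ℤ R} {k d k' d' : ℕ} {z z' : R} (h : PP I k d z)
    (h' : PP I k' d' z') : PP I (k + k') (d + d') (z * z') := by
  unfold PP at *
  rw [pow_add, pow_add, ← smul_mul_smul_comm]
  exact Submodule.mul_mem_mul h h'

theorem PP.one {I : Submodule ℤ R} : PP I 0 0 (1 : R) := by
  unfold PP
  rw [pow_zero, pow_zero, one_smul]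
  exact Submodule.one_le.mp le_rfl

theorem PP.mulr {I : Submodule ℤ R} (hI : TS I) {k d : ℕ} {z : R} (hd : 1 ≤ d) (h : PP I k d z)
    (r : R) : PP I k d (z * r) := by
  unfold PP at *
  obtain ⟨d, rfl⟩ := Nat.exists_eq_add_of_le' hd
  rw [← smul_mul_assoc]
  generalize (3 : ℤ) ^ k • z = w at h
  rw [pow_succ] at h ⊢
  induction h using Submodule.mul_induction_on' with
  | mem_mul_mem a ha b hb =>
    rw [mul_assoc]
    exact Submodule.mul_mem_mul ha (hI b hb r).1
  | add x _ y _ hx hy => rw [add_mul]; exact add_mem hx hy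

theorem PP.add {I : Submodule ℤ R} {k d : ℕ} {z z' : R} (h : PP I k d z)
    (h' : PP I k d z') : PP I k d (z + z') := by
  unfold PP at *
  rw [smul_add]; exact add_mem h h'

theorem PP.sub {I : Submodule ℤ R} {k d : ℕ} {z z' : R} (h : PP I k d z)
    (h' : PP I k d z') : PP I k d (z - z') := by
  unfold PP at *
  rw [smul_sub]; exact sub_mem h h'

theorem PP.smul {I : Submodule ℤ R} {k d : ℕ} {z : R} (h : PP I k d z) (c : ℤ) :
    PP I k d (c • z) := by
  unfold PP at *
  rw [smul_comm]; exact Submodule.smul_mem _ _ h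

theorem PP.dvd {I : Submodule ℤ R} {k d : ℕ} {z : R} (h : PP I k d z) (c : ℤ) (hc : 3 ^ k ∣ c) :
    PP I 0 d (c • z) := by
  obtain ⟨b, rfl⟩ := hc
  have := h.smul b
  unfold PP at *
  rw [mul_comm, mul_smul]
  simpa using Submodule.smul_mem _ b h

theorem CC.mk {I : Submodule ℤ R} {k d k' d' : ℕ} {u v : R} (h : PP I k d u)
    (h' : PP I k' d' v) : CC I (k + k') (d + d') u v := by
  intro a b z hz
  have := (h.mul hz).mul h'
  convert this using 1 <;> ring

theorem pow_exp2 (x : R) (N : ℕ) : ∃ q, (1 + x) ^ N = 1 + (N : ℤ) • x + x ^ 2 * q := by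
  induction N with
  | zero => exact ⟨0, by simp⟩
  | succ N ih =>
    obtain ⟨q, hq⟩ := ih
    refine ⟨q * (1 + x) + (N : ℤ), ?_⟩
    rw [pow_succ, hq]
    simp only [zsmul_eq_mul]
    have := (Int.cast_commute (N : ℤ) x).eq
    push_cast at *
    simp only [mul_add, add_mul, mul_one, one_mul, pow_two, ← mul_assoc, this]
    rw [mul_assoc x _ x, this]
    simp only [← mul_assoc]
    abel

theorem pow_exp5 (x : R) (N : ℕ) : ∃ q, (1 + x) ^ N = 1 + (N : ℤ) • x
    + (N.choose 2 : ℤ) • x ^ 2 + (N.choose 3 : ℤ) • x ^ 3 + (N.choose 4 : ℤ) • x ^ 4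
    + x ^ 5 * q := by
  induction N with
  | zero => exact ⟨0, by simp⟩
  | succ N ih =>
    obtain ⟨q, hq⟩ := ih
    refine ⟨q * (1 + x) + (N.choose 4 : ℤ) • 1, ?_⟩
    rw [pow_succ, hq, Nat.choose_succ_succ N 1, Nat.choose_succ_succ N 2,
      Nat.choose_succ_succ N 3, Nat.choose_one_right]
    push_cast
    simp only [add_smul, mul_add, add_mul, mul_one, one_mul, smul_mul_assoc, mul_smul_comm,
      ← pow_succ, one_smul, mul_assoc, ← pow_two]
    norm_num
    abel

theorem ch2 (n : ℕ) : (3 : ℤ) ^ (n + 1) ∣ ((3 ^ (n + 1)).choose 2 : ℕ) := by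
  have h : (3 ^ (n + 1)).choose 2 * 2 = 3 ^ (n + 1) * (3 ^ (n + 1) - 1) := by
    have := Nat.choose_succ_right_eq (3 ^ (n + 1)) 1
    simpa using this
  have : 3 ^ (n + 1) ∣ (3 ^ (n + 1)).choose 2 :=
    Nat.Coprime.dvd_of_dvd_mul_right (Nat.Coprime.pow_left _ (by norm_num)) ⟨_, h⟩
  exact_mod_cast this

theorem ch3' (n : ℕ) : 3 ^ n ∣ (3 ^ (n + 1)).choose 3 := by
  have h2 : 3 ^ (n + 1) ∣ (3 ^ (n + 1)).choose 2 := by exact_mod_cast ch2 n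
  have h : (3 ^ (n + 1)).choose 3 * 3 = (3 ^ (n + 1)).choose 2 * (3 ^ (n + 1) - 2) :=
    Nat.choose_succ_right_eq (3 ^ (n + 1)) 2
  have : 3 ^ n * 3 ∣ (3 ^ (n + 1)).choose 3 * 3 := by
    rw [h, ← pow_succ]; exact Dvd.dvd.mul_right h2 _
  exact Nat.dvd_of_mul_dvd_mul_right (by norm_num) this

theorem ch3 (n : ℕ) : (3 : ℤ) ^ n ∣ ((3 ^ (n + 1)).choose 3 : ℕ) := by
  exact_mod_cast ch3' n

theorem ch4 (n : ℕ) : (3 : ℤ) ^ n ∣ ((3 ^ (n + 1)).choose 4 : ℕ) := by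
  have h : (3 ^ (n + 1)).choose 4 * 4 = (3 ^ (n + 1)).choose 3 * (3 ^ (n + 1) - 3) :=
    Nat.choose_succ_right_eq (3 ^ (n + 1)) 3
  have : 3 ^ n ∣ (3 ^ (n + 1)).choose 4 :=
    Nat.Coprime.dvd_of_dvd_mul_right (Nat.Coprime.pow_left n (by norm_num : Nat.Coprime 3 4))
      (h ▸ Dvd.dvd.mul_right (ch3' n) _)
  exact_mod_cast this

theorem powlem {I : Submodule ℤ R} {u v x : R} {n : ℕ}
    (h2 : PP I (n + 1) 7 (u * x ^ 2 * v)) (h3 : PP I n 7 (u * x ^ 3 * v))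
    (h4 : PP I n 7 (u * x ^ 4 * v)) (h5 : ∀ q, PP I 0 7 (u * (x ^ 5 * q) * v)) :
    PP I 0 7 (u * ((1 + x) ^ (3 ^ (n + 1)) - 1) * v - (3 : ℤ) ^ (n + 1) • (u * x * v)) := by
  obtain ⟨q, hq⟩ := pow_exp5 x (3 ^ (n + 1))
  have := (((h2.dvd _ (ch2 n)).add (h3.dvd _ (ch3 n))).add (h4.dvd _ (ch4 n))).add (h5 q)
  convert this using 1
  rw [hq]
  simp only [mul_add, add_mul, smul_mul_assoc, mul_smul_comm, add_sub_cancel_left, mul_sub, sub_mul]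
  push_cast
  abel

theorem exch {I : Submodule ℤ R} {u v x y Y : R} {m n k : ℕ}
    (h : (1 + y) ^ (3 ^ (m + 1)) * (1 + x) ^ (3 ^ (n + 1)) = (1 + Y) ^ (3 ^ k))
    (h2 : PP I (n + 1) 7 (u * x ^ 2 * v)) (h3 : PP I n 7 (u * x ^ 3 * v))
    (h4 : PP I n 7 (u * x ^ 4 * v)) (h5 : ∀ q, PP I 0 7 (u * (x ^ 5 * q) * v))
    (k2 : PP I (m + 1) 7 (u * y ^ 2 * v)) (k3 : PP I m 7 (u * y ^ 3 * v))
    (k4 : PP I m 7 (u * y ^ 4 * v)) (k5 : ∀ q, PP I 0 7 (u * (y ^ 5 * q) * v))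
    (hY : PP I k 7 (u * Y * v)) (hY2 : ∀ q, PP I 0 7 (u * (Y ^ 2 * q) * v))
    (hc : PP I 0 7 (u * (((1 + y) ^ (3 ^ (m + 1)) - 1) * ((1 + x) ^ (3 ^ (n + 1)) - 1)) * v)) :
    PP I 0 7 ((3 : ℤ) ^ (n + 1) • (u * x * v) + (3 : ℤ) ^ (m + 1) • (u * y * v)) := by
  have p1 := powlem h2 h3 h4 h5
  have p2 := powlem k2 k3 k4 k5
  obtain ⟨q, hq⟩ := pow_exp2 Y (3 ^ k)
  have p3 := (hY.dvd (3 ^ k) dvd_rfl).add (hY2 q)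
  have e : u * ((1 + y) ^ (3 ^ (m + 1)) - 1) * v + u * ((1 + x) ^ (3 ^ (n + 1)) - 1) * v
      + u * (((1 + y) ^ (3 ^ (m + 1)) - 1) * ((1 + x) ^ (3 ^ (n + 1)) - 1)) * v
      = (3 : ℤ) ^ k • (u * Y * v) + u * (Y ^ 2 * q) * v := by
    have e1 : (1 + y) ^ (3 ^ (m + 1)) * (1 + x) ^ (3 ^ (n + 1)) - 1
        = (3 : ℤ) ^ k • Y + Y ^ 2 * q := by
      rw [h, hq]; push_cast; abel
    have e2 : u * ((3 : ℤ) ^ k • Y + Y ^ 2 * q) * v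
        = (3 : ℤ) ^ k • (u * Y * v) + u * (Y ^ 2 * q) * v := by
      rw [mul_add, add_mul, mul_smul_comm, smul_mul_assoc]
    rw [← e2, ← e1]
    generalize (1 + y) ^ (3 ^ (m + 1)) = a
    generalize (1 + x) ^ (3 ^ (n + 1)) = b
    noncomm_ring
  have := ((p3.sub hc).sub p1).sub p2
  convert this using 1
  rw [← e]
  abel

theorem pow2mem {I : Submodule ℤ R} (hI : TS I) {x : R} {n k : ℕ} (hx : PP I 0 1 x)
    (hx2 : PP I k 2 x) (h : k ≤ n) : PP I 0 2 ((1 + x) ^ (3 ^ n) - 1) := by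
  obtain ⟨q, hq⟩ := pow_exp2 x (3 ^ n)
  have h1 := hx2.dvd ((3 ^ n : ℕ) : ℤ) (by push_cast; exact pow_dvd_pow _ h)
  have h2 := (hx.mul hx).mulr hI (by norm_num) q
  rw [← pow_two] at h2
  have := h1.add h2
  convert this using 1
  rw [hq]; abel

theorem lemA {I : Submodule ℤ R} (hI : TS I) {u v x y Y : R} {m kw kx : ℕ}
    (hw : 2 ≤ kw ∧ kw ≤ 4) (hs : kx + kw = 6) (hm : 9 ≤ m)
    (c0 : CC I 0 3 u v) (c1 : CC I kw 4 u v)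
    (x1 : PP I 0 1 x) (x2 : PP I kx 2 x) (y1 : PP I 0 1 y) (y2 : PP I 6 2 y)
    (hY : PP I 0 3 Y)
    (h : (1 + y) ^ (3 ^ (m + 1)) * (1 + x) ^ (3 ^ 9) = (1 + Y) ^ (3 ^ kw)) :
    PP I 0 7 ((3 : ℤ) ^ 9 • (u * x * v) + (3 : ℤ) ^ (m + 1) • (u * y * v)) := by
  obtain ⟨hw1, hw2⟩ := hw
  have hp : ∀ {z : R}, PP I 0 1 z → ∀ j, PP I 0 j (z ^ j) := by
    intro z hz j
    induction j with
    | zero => simpa using PP.one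
    | succ j ih => rw [pow_succ]; exact ih.mul hz
  refine exch (n := 8) h ?_ ?_ ?_ ?_ ?_ ?_ ?_ ?_ ?_ ?_ ?_
  · rw [pow_two]; exact (c1 _ _ _ (x2.mul x1)).mono hI _ _ (by omega) (by omega) (by omega)
  · exact (c1 _ _ _ (hp x1 3)).mono hI _ _ (by omega) (by omega) (by omega)
  · exact (c1 _ _ _ (hp x1 4)).mono hI _ _ (by omega) (by omega) (by omega)
  · intro q
    exact (c0 _ _ _ ((hp x1 5).mulr hI (by omega) q)).mono hI _ _ (by omega) (by omega) (by omega)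
  · rw [pow_two]; exact (c1 _ _ _ (y2.mul y1)).mono hI _ _ (by omega) (by omega) (by omega)
  · exact (c1 _ _ _ (hp y1 3)).mono hI _ _ (by omega) (by omega) (by omega)
  · exact (c1 _ _ _ (hp y1 4)).mono hI _ _ (by omega) (by omega) (by omega)
  · intro q
    exact (c0 _ _ _ ((hp y1 5).mulr hI (by omega) q)).mono hI _ _ (by omega) (by omega) (by omega)
  · exact (c1 _ _ _ hY).mono hI _ _ (by omega) (by omega) (by omega)
  · intro q
    rw [pow_two]
    exact (c0 _ _ _ ((hY.mul hY).mulr hI (by omega) q)).mono hI _ _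
      (by omega) (by omega) (by omega)
  · exact (c0 _ _ _ ((pow2mem hI y1 y2 (by omega)).mul (pow2mem hI x1 x2 (by omega)))).mono hI _ _
      (by omega) (by omega) (by omega)

theorem lemB {I : Submodule ℤ R} (hI : TS I) {u v x z Y : R} {n kw kx : ℕ}
    (hw : 2 ≤ kw ∧ kw ≤ 4) (hs : kx + kw = 6) (hn : 9 ≤ n)
    (c0 : CC I 0 2 u v) (c1 : CC I kw 3 u v) (c2 : CC I (6 + kw) 4 u v)
    (x1 : PP I 0 1 x) (x2 : PP I kx 2 x) (z2 : PP I 0 2 z)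
    (hY : PP I 0 3 Y)
    (h : (1 + x) ^ (3 ^ 12) * (1 + z) ^ (3 ^ (n + 1)) = (1 + Y) ^ (3 ^ (6 + kw))) :
    PP I 0 7 ((3 : ℤ) ^ (n + 1) • (u * z * v) + (3 : ℤ) ^ 12 • (u * x * v)) := by
  obtain ⟨hw1, hw2⟩ := hw
  have hp : ∀ {z : R} {d : ℕ}, PP I 0 d z → ∀ j, PP I 0 (d * j) (z ^ j) := by
    intro z d hz j
    induction j with
    | zero => simpa using PP.one
    | succ j ih => rw [pow_succ]; exact ih.mul hz
  refine exch (m := 11) h ?_ ?_ ?_ ?_ ?_ ?_ ?_ ?_ ?_ ?_ ?_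
  · exact (c1 _ _ _ (hp z2 2)).mono hI _ _ (by omega) (by omega) (by omega)
  · exact (c1 _ _ _ (hp z2 3)).mono hI _ _ (by omega) (by omega) (by omega)
  · exact (c1 _ _ _ (hp z2 4)).mono hI _ _ (by omega) (by omega) (by omega)
  · intro q
    exact (c0 _ _ _ ((hp z2 5).mulr hI (by omega) q)).mono hI _ _ (by omega) (by omega) (by omega)
  · rw [pow_two]; exact (c2 _ _ _ (x2.mul x1)).mono hI _ _ (by omega) (by omega) (by omega)
  · exact (c2 _ _ _ (hp x1 3)).mono hI _ _ (by omega) (by omega) (by omega)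
  · exact (c2 _ _ _ (hp x1 4)).mono hI _ _ (by omega) (by omega) (by omega)
  · intro q
    exact (c0 _ _ _ ((hp x1 5).mulr hI (by omega) q)).mono hI _ _ (by omega) (by omega) (by omega)
  · exact (c2 _ _ _ hY).mono hI _ _ (by omega) (by omega) (by omega)
  · intro q
    exact (c0 _ _ _ ((hp hY 2).mulr hI (by omega) q)).mono hI _ _
      (by omega) (by omega) (by omega)
  · have ha : PP I 0 2 ((1 + x) ^ (3 ^ (11 + 1)) - 1) := pow2mem hI x1 x2 (by omega)
    generalize (1 + x) ^ (3 ^ (11 + 1)) - 1 = a at ha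
    obtain ⟨q, hq⟩ := pow_exp2 z (3 ^ (n + 1))
    have t1 := (c2 _ _ _ (ha.mul z2)).mono hI (n + 1) 7 (by omega) (by omega) (by omega)
    have t1 := t1.dvd ((3 ^ (n + 1) : ℕ) : ℤ) (by push_cast; exact dvd_rfl)
    have t2 := (c0 _ _ _ (ha.mul ((hp z2 2).mulr hI (by omega) q))).mono hI 0 7
      (by omega) (by omega) (by omega)
    convert t1.add t2 using 1
    rw [hq, add_assoc, add_sub_cancel_left, ← smul_mul_assoc, ← mul_smul_comm,
      ← mul_smul_comm, ← add_mul, ← mul_add, ← mul_add]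

theorem ring_main {I : Submodule ℤ R} (hI : TS I) {x0 x1 x2 x3 Y01 Y02 Y13 Y23 : R}
    (h0 : PP I 0 2 x0) (h1 : PP I 0 1 x1) (h1' : PP I 2 2 x1) (h2 : PP I 0 1 x2)
    (h2' : PP I 4 2 x2) (h3 : PP I 0 1 x3) (h3' : PP I 6 2 x3)
    (k01 : PP I 0 3 Y01) (k02 : PP I 0 3 Y02) (k13 : PP I 0 3 Y13) (k23 : PP I 0 3 Y23)
    (r01 : (1 + x1) ^ (3 ^ 12) * (1 + x0) ^ (3 ^ 11) = (1 + Y01) ^ (3 ^ 10))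
    (r02 : (1 + x2) ^ (3 ^ 12) * (1 + x0) ^ (3 ^ 10) = (1 + Y02) ^ (3 ^ 8))
    (r13 : (1 + x3) ^ (3 ^ 11) * (1 + x1) ^ (3 ^ 9) = (1 + Y13) ^ (3 ^ 4))
    (r23 : (1 + x3) ^ (3 ^ 10) * (1 + x2) ^ (3 ^ 9) = (1 + Y23) ^ (3 ^ 2)) :
    PP I 9 7 ((x2 * x1 - x1 * x2) * x0 - x0 * (x2 * x1 - x1 * x2)) := by
  have a1 := lemA hI (m := 10) (kw := 4) (kx := 2) (by norm_num) (by norm_num) (by norm_num)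
    (CC.mk h2 h0) (CC.mk h2' h0) h1 h1' h3 h3' k13 r13
  have b1 := lemB hI (n := 10) (kw := 4) (kx := 2) (by norm_num) (by norm_num) (by norm_num)
    (CC.mk (h2.mul h3) PP.one) (CC.mk (h2'.mul h3) PP.one) (CC.mk (h2'.mul h3') PP.one)
    h1 h1' h0 k01 r01
  have a2 := lemA hI (m := 9) (kw := 2) (kx := 4) (by norm_num) (by norm_num) (by norm_num)
    (CC.mk h0 h1) (CC.mk h0 h1') h2 h2' h3 h3' k23 r23
  have b2 := lemB hI (n := 9) (kw := 2) (kx := 4) (by norm_num) (by norm_num) (by norm_num)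
    (CC.mk PP.one (h3.mul h1)) (CC.mk PP.one (h3.mul h1')) (CC.mk PP.one (h3'.mul h1'))
    h2 h2' h0 k02 r02
  have a3 := lemA hI (m := 9) (kw := 2) (kx := 4) (by norm_num) (by norm_num) (by norm_num)
    (CC.mk h1 h0) (CC.mk h1' h0) h2 h2' h3 h3' k23 r23
  have b3 := lemB hI (n := 9) (kw := 2) (kx := 4) (by norm_num) (by norm_num) (by norm_num)
    (CC.mk (h1.mul h3) PP.one) (CC.mk (h1'.mul h3) PP.one) (CC.mk (h1'.mul h3') PP.one)
    h2 h2' h0 k02 r02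
  have a4 := lemA hI (m := 10) (kw := 4) (kx := 2) (by norm_num) (by norm_num) (by norm_num)
    (CC.mk h0 h2) (CC.mk h0 h2') h1 h1' h3 h3' k13 r13
  have b4 := lemB hI (n := 10) (kw := 4) (kx := 2) (by norm_num) (by norm_num) (by norm_num)
    (CC.mk PP.one (h3.mul h2)) (CC.mk PP.one (h3.mul h2')) (CC.mk PP.one (h3'.mul h2'))
    h1 h1' h0 k01 r01
  have := (((a1.sub b1).sub (a2.sub b2)).sub (a3.sub b3)).add (a4.sub b4)
  unfold PP at this ⊢
  rw [pow_zero, one_smul] at this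
  convert this using 1
  simp only [mul_sub, sub_mul, smul_sub, one_mul, mul_one, ← mul_assoc]
  abel

end ring

section grp
variable {G : Type*} [Group G]

theorem aug_TS : TS (augIdeal G) := by
  intro a ha r
  unfold augIdeal at *
  rw [Submodule.restrictScalars_mem] at *
  constructor
  · rw [RingHom.mem_ker] at *
    rw [map_mul, ha, zero_mul]
  · exact Ideal.mul_mem_left _ _ ha

/-- group element in the ring -/
noncomputable def gg (g : G) : MonoidAlgebra ℤ G := MonoidAlgebra.of ℤ G g

theorem gg_mul (a b : G) : gg (a * b) = gg a * gg b := map_mul _ _ _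
theorem gg_pow (a : G) (n : ℕ) : gg (a ^ n) = gg a ^ n := map_pow _ _ _
theorem gg_inv (a : G) : gg a * gg a⁻¹ = 1 := by
  rw [← gg_mul, mul_inv_cancel]; exact map_one _

theorem gg_aug (g : G) : PP (augIdeal G) 0 1 (gg g - 1) := by
  unfold PP augIdeal gg
  rw [pow_zero, one_smul, pow_one, Submodule.restrictScalars_mem, RingHom.mem_ker]
  simp

theorem gg_comm (a b : G) : gg ⁅a, b⁆ - 1 =
    ((gg a - 1) * (gg b - 1) - (gg b - 1) * (gg a - 1)) * gg (a⁻¹ * b⁻¹) := by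
  have : gg ⁅a, b⁆ - 1 = (gg a * gg b - gg b * gg a) * gg (a⁻¹ * b⁻¹) := by
    rw [sub_mul, ← gg_mul, ← gg_mul, ← gg_mul, ← gg_mul, commutatorElement_def]
    congr 1
    · congr 1; group
    · rw [show b * a * (a⁻¹ * b⁻¹) = 1 by group]; exact (map_one _).symm
  rw [this]
  noncomm_ring

theorem gg_comm_mem {a b : G} {i j : ℕ} (hi : 1 ≤ i) (ha : PP (augIdeal G) 0 i (gg a - 1))
    (hb : PP (augIdeal G) 0 j (gg b - 1)) : PP (augIdeal G) 0 (i + j) (gg ⁅a, b⁆ - 1) := by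
  rw [gg_comm]
  refine PP.mulr aug_TS (by omega) ?_ _
  refine (ha.mul hb).sub ?_
  have := hb.mul ha
  rwa [add_comm j i] at this

theorem gg_tors {a b : G} {k : ℕ} (hb : PP (augIdeal G) 0 2 (gg b - 1)) (h : a ^ (3 ^ k) = b) :
    PP (augIdeal G) k 2 (gg a - 1) := by
  obtain ⟨q, hq⟩ := pow_exp2 (gg a - 1) (3 ^ k)
  rw [add_sub_cancel, ← gg_pow, h] at hq
  have h2 := ((gg_aug a).mul (gg_aug a)).mulr aug_TS (by norm_num) q
  have := hb.sub h2
  unfold PP at *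
  rw [pow_zero, one_smul] at this
  convert this using 1
  rw [hq, pow_two]; push_cast; abel

theorem grp_main (e0 e1 e2 e3 y01 y02 y13 y23 : G)
    (h0 : PP (augIdeal G) 0 2 (gg e0 - 1)) (h1' : PP (augIdeal G) 2 2 (gg e1 - 1))
    (h2' : PP (augIdeal G) 4 2 (gg e2 - 1)) (h3' : PP (augIdeal G) 6 2 (gg e3 - 1))
    (k01 : PP (augIdeal G) 0 3 (gg y01 - 1)) (k02 : PP (augIdeal G) 0 3 (gg y02 - 1))
    (k13 : PP (augIdeal G) 0 3 (gg y13 - 1)) (k23 : PP (augIdeal G) 0 3 (gg y23 - 1))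
    (r01 : e1 ^ (3 ^ 12) * e0 ^ (3 ^ 11) = y01 ^ (3 ^ 10))
    (r02 : e2 ^ (3 ^ 12) * e0 ^ (3 ^ 10) = y02 ^ (3 ^ 8))
    (r13 : e3 ^ (3 ^ 11) * e1 ^ (3 ^ 9) = y13 ^ (3 ^ 4))
    (r23 : e3 ^ (3 ^ 10) * e2 ^ (3 ^ 9) = y23 ^ (3 ^ 2)) :
    PP (augIdeal G) 0 7 (gg (⁅⁅e2, e1⁆, e0⁆ ^ (3 ^ 9)) - 1) := by
  have hI : TS (augIdeal G) := aug_TS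
  have key : ∀ {a b y : G} {k l m : ℕ}, a ^ k * b ^ l = y ^ m →
      (1 + (gg a - 1)) ^ k * (1 + (gg b - 1)) ^ l = (1 + (gg y - 1)) ^ m := by
    intro a b y k l m h
    simp only [add_sub_cancel]
    rw [← gg_pow, ← gg_pow, ← gg_pow, ← gg_mul, h]
  have M := ring_main hI h0 (gg_aug e1) h1' (gg_aug e2) h2' (gg_aug e3) h3' k01 k02 k13 k23
    (key r01) (key r02) (key r13) (key r23)
  have ha : PP (augIdeal G) 0 2 (gg ⁅e2, e1⁆ - 1) :=
    gg_comm_mem (by norm_num) (gg_aug e2) (gg_aug e1)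
  have hc : PP (augIdeal G) 0 4 (gg ⁅⁅e2, e1⁆, e0⁆ - 1) := gg_comm_mem (by norm_num) ha h0
  -- the commutator of ring elements
  have hB : PP (augIdeal G) 6 4 ((gg e2 - 1) * (gg e1 - 1) - (gg e1 - 1) * (gg e2 - 1)) :=
    (h2'.mul h1').sub (h1'.mul h2')
  have hA : PP (augIdeal G) 9 7 ((gg ⁅e2, e1⁆ - 1) * (gg e0 - 1)
      - (gg e0 - 1) * (gg ⁅e2, e1⁆ - 1)) := by
    have hh := gg_aug (e2⁻¹ * e1⁻¹)
    rw [gg_comm e2 e1]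
    generalize (gg e2 - 1) * (gg e1 - 1) - (gg e1 - 1) * (gg e2 - 1) = B at *
    generalize gg (e2⁻¹ * e1⁻¹) = w at *
    have t1 := ((hB.mul hh).mul h0).mono hI 9 7 (by norm_num) (by norm_num) (by norm_num)
    have t2 := (h0.mul (hB.mul hh)).mono hI 9 7 (by norm_num) (by norm_num) (by norm_num)
    convert (M.add t1).sub t2 using 1
    noncomm_ring
  have hC : PP (augIdeal G) 9 7 (gg ⁅⁅e2, e1⁆, e0⁆ - 1) := by
    rw [gg_comm]
    exact hA.mulr hI (by norm_num) _
  obtain ⟨q, hq⟩ := pow_exp2 (gg ⁅⁅e2, e1⁆, e0⁆ - 1) (3 ^ 9)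
  rw [add_sub_cancel, ← gg_pow] at hq
  have t1 := hC.dvd ((3 ^ 9 : ℕ) : ℤ) (by norm_num)
  have t2 := ((hc.mul hc).mulr hI (by norm_num) q).mono hI 0 7 (by norm_num) (by norm_num)
    (by norm_num)
  rw [← pow_two] at t2
  convert t1.add t2 using 1
  rw [hq]; abel

end grp

/-- quotient map -/
def qT : FreeGroup TGen →* TGrp := PresentedGroup.mk tRels

theorem qT_rel (w : FreeGroup TGen) (h : w ∈ tRels) : qT w = 1 :=
  PresentedGroup.one_of_mem h

theorem qT_e (i : Fin 4) : qT (eF i) = eT i := rfl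

theorem relA (i : Fin 4) : eT i ^ (3 ^ (2 * (i : ℕ))) = qT (yF i) := by
  have := qT_rel _ (Or.inl ⟨i, rfl⟩)
  rw [map_mul, map_pow, map_inv, qT_e] at this
  exact mul_inv_eq_one.mp this

theorem relB (k : Fin 4) : eT (pairIdx k).2 ^ (3 ^ (12 - ((pairIdx k).1 : ℕ)))
      * eT (pairIdx k).1 ^ (3 ^ (12 - ((pairIdx k).2 : ℕ)))
      = qT (yyF k) ^ (3 ^ (12 - 2 * ((pairIdx k).1 : ℕ) - 2 * ((pairIdx k).2 : ℕ))) := by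
  have := qT_rel _ (Or.inr ⟨k, rfl⟩)
  rw [map_mul, map_mul, map_pow, map_pow, map_inv, map_pow, qT_e, qT_e] at this
  exact mul_inv_eq_one.mp this

theorem y_mem (i : Fin 4) : PP (augIdeal TGrp) 0 2 (gg (qT (yF i)) - 1) := by
  unfold yF
  rw [map_commutatorElement]
  exact gg_comm_mem (by norm_num) (gg_aug _) (gg_aug _)

theorem yy_mem (i : Fin 4) : PP (augIdeal TGrp) 0 3 (gg (qT (yyF i)) - 1) := by
  unfold yyF
  rw [map_commutatorElement, map_commutatorElement]
  exact gg_comm_mem (by norm_num) (gg_comm_mem (by norm_num) (gg_aug _) (gg_aug _)) (gg_aug _)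

/-- The element `ω = [[e_2, e_1], e_0]^{3⁹}` lies in the dimension subgroup `δ_7(G)`. -/
theorem three_torsion_group_example_delta :
    (⁅⁅eT 2, eT 1⁆, eT 0⁆ ^ (3 ^ 9)) ∈ dimensionSubgroup TGrp 7 := by
  have M := grp_main (eT 0) (eT 1) (eT 2) (eT 3) (qT (yyF 0)) (qT (yyF 1)) (qT (yyF 2))
    (qT (yyF 3)) (gg_tors (y_mem 0) (relA 0)) (gg_tors (y_mem 1) (relA 1))
    (gg_tors (y_mem 2) (relA 2)) (gg_tors (y_mem 3) (relA 3))
    (yy_mem 0) (yy_mem 1) (yy_mem 2) (yy_mem 3) (relB 0) (relB 1) (relB 2) (relB 3)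
  unfold PP at M
  rw [pow_zero, one_smul] at M
  exact M
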